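/- arXiv:math/0508541 — 4 statements merged into one kernel-verified Lean document; each statement's English description precedes it below -/
import Mathlib

section
/- Let d : ℕ → ℕ and define e : ℕ → ℕ by e(1) = 1 and e(k) = d(k) + 2 for k ≥ 2. Suppose that for every g ≥ 2 one has d(g) = max( 3g − 3 , max_{1 ≤ h ≤ ⌊g/2⌋} ( e(h) + e(g − h) ) ). Then for every g ≥ 2, d(g) = ⌊(7g − 8)/2⌋. -/
/-- The arithmetic recursion for the Stratified Morse Theory upper bound `d g` on the
CW-dimension of the Torelli space of genus `g` curves of compact type, where
`e h = d (h, 1)` with `e 1 = 1` and `e k = d k + 2` for `k ≥ 2`.  The recursion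
`d g = max (3g-3) (max_{1 ≤ h ≤ ⌊g/2⌋} (e h + e (g-h)))` has the closed-form solution
`d g = ⌊(7g-8)/2⌋`. -/
theorem stmt0 (d e : ℕ → ℕ)
    (he1 : e 1 = 1)
    (he : ∀ k, 2 ≤ k → e k = d k + 2)
    (hd : ∀ g, 2 ≤ g →
      d g = max (3 * g - 3) ((Finset.Icc 1 (g / 2)).sup fun h => e h + e (g - h))) :
    ∀ g, 2 ≤ g → d g = (7 * g - 8) / 2 := by
  intro g
  induction g using Nat.strong_induction_on with
  | _ g ih =>
    intro hg
    have e_eq : ∀ k, 1 ≤ k → k < g → e k = (7 * k - 4) / 2 := by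
      intro k hk hkg
      obtain rfl | hk2 : k = 1 ∨ 2 ≤ k := by omega
      · exact he1
      · rw [he k hk2, ih k hkg hk2]
        omega
    rw [hd g hg]
    apply le_antisymm
    · refine max_le (by omega) (Finset.sup_le fun h hh => ?_)
      rw [Finset.mem_Icc] at hh
      rw [e_eq h (by omega) (by omega), e_eq (g - h) (by omega) (by omega)]
      omega
    · obtain hg3 | hg4 : g ≤ 3 ∨ 4 ≤ g := by omega
      · exact le_max_of_le_left (by omega)
      · have hsup := Finset.le_sup (f := fun h => e h + e (g - h))
          (Finset.mem_Icc.mpr ⟨one_le_two, (by omega : 2 ≤ g / 2)⟩)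
        refine le_max_of_le_right (le_trans ?_ hsup)
        rw [e_eq 2 (by omega) (by omega), e_eq (g - 2) (by omega) (by omega)]
        omega
end

section
/- For every g ≥ 2, there exists an injective group homomorphism from the symmetric group S_{2g+2} on 2g+2 letters into the symplectic group Sp_g(𝔽₂) of 2g × 2g matrices over 𝔽₂ preserving the standard symplectic form. -/
open Matrix in
/-- The map from permutations of `ι` to matrices obtained by restricting permutation matrices to
the span of the rows of `B`. -/
def compressPerm {l ι : Type*} [Fintype l] [DecidableEq l] [Fintype ι] [DecidableEq ι]
    (B : Matrix (l ⊕ l) ι (ZMod 2)) (σ : Equiv.Perm ι) : Matrix (l ⊕ l) (l ⊕ l) (ZMod 2) :=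
  B * (σ⁻¹).permMatrix (ZMod 2) * Bᵀ * J l (ZMod 2)

section General

open Matrix

variable {l ι : Type*} [Fintype l] [DecidableEq l] [Fintype ι] [DecidableEq ι]

lemma neg_matrix_zmod_two {m n : Type*} (A : Matrix m n (ZMod 2)) : -A = A := by
  ext i j
  exact ZMod.neg_eq_self_mod_two _

lemma J_mul_J_zmod_two : J l (ZMod 2) * J l (ZMod 2) = 1 := by
  rw [J_squared, neg_matrix_zmod_two]

lemma permMatrix_mulVec_one (σ : Equiv.Perm ι) :
    (σ.permMatrix (ZMod 2)) *ᵥ (1 : ι → ZMod 2) = 1 := by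
  rw [permMatrix_mulVec]
  rfl

lemma one_vecMul_permMatrix (σ : Equiv.Perm ι) :
    (1 : ι → ZMod 2) ᵥ* (σ.permMatrix (ZMod 2)) = 1 := by
  rw [vecMul_permMatrix]
  rfl

variable {B : Matrix (l ⊕ l) ι (ZMod 2)} {a b : ι → ZMod 2}

lemma mul_permMatrix_middle (hone : B *ᵥ 1 = 0)
    (hK : Bᵀ * J l (ZMod 2) * B = 1 + (vecMulVec 1 a + vecMulVec b 1)) (σ τ : Equiv.Perm ι) :
    B * σ.permMatrix (ZMod 2) * (Bᵀ * J l (ZMod 2) * B) * (τ.permMatrix (ZMod 2) * Bᵀ) =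
      B * (σ.permMatrix (ZMod 2) * τ.permMatrix (ZMod 2)) * Bᵀ := by
  have h₁ : (B * σ.permMatrix (ZMod 2)) *ᵥ 1 = 0 := by
    rw [← mulVec_mulVec, permMatrix_mulVec_one, hone]
  have h₂ : 1 ᵥ* (τ.permMatrix (ZMod 2) * Bᵀ) = 0 := by
    rw [← vecMul_vecMul, one_vecMul_permMatrix, vecMul_transpose, hone]
  rw [hK, Matrix.mul_add, Matrix.mul_add, mul_vecMulVec, h₁, Matrix.add_mul, Matrix.add_mul,
    mul_vecMulVec, vecMulVec_mul _ 1, h₂]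
  simp [Matrix.mul_assoc]

lemma compressPerm_one (hB : B * Bᵀ = J l (ZMod 2)) : compressPerm B 1 = 1 := by
  simp [compressPerm, hB, J_mul_J_zmod_two]

lemma compressPerm_mul (hone : B *ᵥ 1 = 0)
    (hK : Bᵀ * J l (ZMod 2) * B = 1 + (vecMulVec 1 a + vecMulVec b 1)) (σ τ : Equiv.Perm ι) :
    compressPerm B (σ * τ) = compressPerm B σ * compressPerm B τ := by
  have h := mul_permMatrix_middle hone hK σ⁻¹ τ⁻¹
  simp only [compressPerm, _root_.mul_inv_rev, Matrix.permMatrix_mul]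
  rw [← h]
  simp only [Matrix.mul_assoc]

lemma compressPerm_mem (hB : B * Bᵀ = J l (ZMod 2)) (hone : B *ᵥ 1 = 0)
    (hK : Bᵀ * J l (ZMod 2) * B = 1 + (vecMulVec 1 a + vecMulVec b 1)) (σ : Equiv.Perm ι) :
    compressPerm B σ ∈ symplecticGroup l (ZMod 2) := by
  rw [SymplecticGroup.mem_iff]
  have h := mul_permMatrix_middle hone hK σ⁻¹ σ
  rw [← Matrix.permMatrix_mul, mul_inv_cancel, Matrix.permMatrix_one, Matrix.mul_one, hB] at h
  refine Eq.trans ?_ h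
  simp only [compressPerm, transpose_mul, J_transpose, neg_matrix_zmod_two, transpose_transpose,
    transpose_permMatrix, inv_inv]
  simp only [Matrix.mul_assoc]
  rw [← Matrix.mul_assoc (J l _) (J l _), J_mul_J_zmod_two, Matrix.one_mul]

lemma exists_permMatrix_eq_one_add_of_compressPerm_eq_one (hB : B * Bᵀ = J l (ZMod 2))
    (hK : Bᵀ * J l (ZMod 2) * B = 1 + (vecMulVec 1 a + vecMulVec b 1)) {σ : Equiv.Perm ι}
    (hσ : compressPerm B σ = 1) :
    ∃ r c : ι → ZMod 2, ∀ i j,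
      (σ⁻¹).permMatrix (ZMod 2) i j = (1 : Matrix ι ι (ZMod 2)) i j + (r i + c j) := by
  set P := (σ⁻¹).permMatrix (ZMod 2) with hP
  set K := Bᵀ * J l (ZMod 2) * B with hKdef
  have hKT : Kᵀ = K := by
    simp [hKdef, neg_matrix_zmod_two, Matrix.mul_assoc]
  have h₁ : B * P * Bᵀ = J l (ZMod 2) := by
    have := congrArg (· * J l (ZMod 2)) hσ
    simpa [compressPerm, Matrix.mul_assoc, J_mul_J_zmod_two] using this
  have h₂ : K * (P - 1) * K = 0 := by
    have : K * (P - 1) * K = Bᵀ * J l (ZMod 2) * (B * P * Bᵀ - B * Bᵀ) * (J l (ZMod 2) * B) := by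
      simp only [hKdef, Matrix.mul_sub, Matrix.sub_mul, Matrix.mul_assoc, Matrix.mul_one]
    rw [this, h₁, hB]
    simp
  have hN₁ : (P - 1) *ᵥ 1 = 0 := by
    rw [sub_mulVec, permMatrix_mulVec_one, one_mulVec, sub_self]
  have hN₂ : 1 ᵥ* (P - 1) = 0 := by
    rw [vecMul_sub, one_vecMul_permMatrix, vecMul_one, sub_self]
  have h₃ : (P - 1) * K = (P - 1) + vecMulVec ((P - 1) *ᵥ b) 1 := by
    rw [hK, Matrix.mul_add, Matrix.mul_add, mul_vecMulVec, hN₁, mul_vecMulVec]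
    simp
  have h₄ : K * (P - 1) = (P - 1) + vecMulVec 1 (b ᵥ* (P - 1)) := by
    rw [← hKT, hK, transpose_add, transpose_add, transpose_vecMulVec, transpose_vecMulVec,
      Matrix.add_mul, Matrix.add_mul, vecMulVec_mul, vecMulVec_mul, hN₂]
    simp
  rw [Matrix.mul_assoc, h₃, Matrix.mul_add, h₄, mul_vecMulVec] at h₂
  refine ⟨-(K *ᵥ ((P - 1) *ᵥ b)), -(b ᵥ* (P - 1)), fun i j => ?_⟩
  have h₅ := congrFun₂ h₂ i j
  simp only [Matrix.add_apply, Matrix.sub_apply, vecMulVec_apply, Pi.one_apply, one_mul, mul_one,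
    Matrix.zero_apply] at h₅
  simp only [Pi.neg_apply]
  linear_combination h₅

lemma exists_ne_of_five_le_card (hι : 5 ≤ Fintype.card ι) (w x y z : ι) :
    ∃ t, t ≠ w ∧ t ≠ x ∧ t ≠ y ∧ t ≠ z := by
  obtain ⟨t, ht⟩ := Finset.exists_mem_notMem_of_card_lt_card
    (s := {w, x, y, z}) (t := (Finset.univ : Finset ι))
    (by have := Finset.card_le_four (a := w) (b := x) (c := y) (d := z)
        rw [Finset.card_univ]
        omega)
  exact ⟨t, by simpa using ht.2⟩

lemma eq_one_of_permMatrix_eq_one_add (hι : 5 ≤ Fintype.card ι) {σ : Equiv.Perm ι}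
    {r c : ι → ZMod 2}
    (h : ∀ i j, σ.permMatrix (ZMod 2) i j = (1 : Matrix ι ι (ZMod 2)) i j + (r i + c j)) :
    σ = 1 := by
  ext i
  by_contra hi
  rw [Equiv.Perm.one_apply] at hi
  obtain ⟨j, hji, hjk, -, -⟩ := exists_ne_of_five_le_card hι i (σ i) i i
  obtain ⟨m, hmi, hmk, hmj, hms⟩ := exists_ne_of_five_le_card hι i (σ i) j (σ j)
  have h₁ := h i (σ i)
  have h₂ := h i m
  have h₃ := h j (σ i)
  have h₄ := h j m
  simp [PEquiv.toMatrix_apply, hji, hjk, hmi.symm, hmj.symm, hmk.symm, hms.symm, Ne.symm hi]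
    at h₁ h₂ h₃ h₄
  have : (1 : ZMod 2) = 0 := by linear_combination h₁ - h₂ - h₃ + h₄
  exact one_ne_zero this

lemma exists_injective_hom_symplecticGroup (hι : 5 ≤ Fintype.card ι)
    (hB : B * Bᵀ = J l (ZMod 2)) (hone : B *ᵥ 1 = 0)
    (hK : Bᵀ * J l (ZMod 2) * B = 1 + (vecMulVec 1 a + vecMulVec b 1)) :
    ∃ φ : Equiv.Perm ι →* symplecticGroup l (ZMod 2), Function.Injective φ := by
  refine ⟨MonoidHom.codRestrict
    { toFun := compressPerm B
      map_one' := compressPerm_one hB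
      map_mul' := compressPerm_mul hone hK } _ (compressPerm_mem hB hone hK), ?_⟩
  have key : ∀ σ, compressPerm B σ = 1 → σ = 1 := fun σ hσ => by
    obtain ⟨r, c, h⟩ := exists_permMatrix_eq_one_add_of_compressPerm_eq_one hB hK hσ
    exact inv_eq_one.mp (eq_one_of_permMatrix_eq_one_add hι h)
  refine (injective_iff_map_eq_one _).mpr fun σ hσ => key σ ?_
  exact congrArg Subtype.val hσ

end General

section Basis

open Matrix

/-- Rows representing a symplectic basis of the even subsets of `Fin (2 * g + 2)` modulo
complements: the pairs `{2k, 2k+1}` and the intervals `{2k+1, …, 2g}`. -/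
def evenBasis (g : ℕ) : Matrix (Fin g ⊕ Fin g) (Fin (2 * g + 2)) (ZMod 2) :=
  Matrix.of fun s i => s.elim (fun k : Fin g => if (i : ℕ) / 2 = k then 1 else 0)
    (fun k : Fin g => if 2 * (k : ℕ) + 1 ≤ i ∧ (i : ℕ) ≤ 2 * g then 1 else 0)

variable {g : ℕ}

lemma evenBasis_inl (k : Fin g) (i : Fin (2 * g + 2)) :
    evenBasis g (.inl k) i = if (i : ℕ) / 2 = k then 1 else 0 := rfl

lemma evenBasis_inr (k : Fin g) (i : Fin (2 * g + 2)) :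
    evenBasis g (.inr k) i = if 2 * (k : ℕ) + 1 ≤ i ∧ (i : ℕ) ≤ 2 * g then 1 else 0 := rfl

lemma evenBasis_inl_dotProduct (k : Fin g) (v : Fin (2 * g + 2) → ZMod 2) :
    evenBasis g (.inl k) ⬝ᵥ v = v ⟨2 * k, by omega⟩ + v ⟨2 * k + 1, by omega⟩ := by
  rw [dotProduct, ← Finset.sum_subset (Finset.subset_univ
    {(⟨2 * k, by omega⟩ : Fin (2 * g + 2)), ⟨2 * k + 1, by omega⟩}), Finset.sum_pair]
  · have h : (2 * (k : ℕ) + 1) / 2 = k := by omega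
    simp [evenBasis_inl, h]
  · simp
  · intro i _ hi
    have : (i : ℕ) / 2 ≠ k := by
      simp only [Finset.mem_insert, Finset.mem_singleton, Fin.ext_iff] at hi
      omega
    simp [evenBasis_inl, this]

lemma sum_ite_odd_interval (m : ℕ) (hm : m ≤ g) :
    (∑ i : Fin (2 * g + 2), if 2 * m + 1 ≤ (i : ℕ) ∧ (i : ℕ) ≤ 2 * g then (1 : ZMod 2) else 0) =
      0 := by
  rw [Fin.sum_univ_eq_sum_range
    (fun i => if 2 * m + 1 ≤ i ∧ i ≤ 2 * g then (1 : ZMod 2) else 0), ← Finset.sum_filter]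
  have : (Finset.range (2 * g + 2)).filter (fun i => 2 * m + 1 ≤ i ∧ i ≤ 2 * g) =
      Finset.Icc (2 * m + 1) (2 * g) := by
    ext i
    simp only [Finset.mem_filter, Finset.mem_range, Finset.mem_Icc]
    omega
  rw [this, Finset.sum_const, Nat.card_Icc, nsmul_one, ZMod.natCast_eq_zero_iff]
  omega

lemma evenBasis_inr_dotProduct_inr (j k : Fin g) :
    evenBasis g (.inr j) ⬝ᵥ evenBasis g (.inr k) = 0 := by
  rw [← sum_ite_odd_interval (max (j : ℕ) k) (max_le j.2.le k.2.le), dotProduct]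
  refine Finset.sum_congr rfl fun i _ => ?_
  rw [evenBasis_inr, evenBasis_inr]
  split_ifs <;> first | omega | simp

lemma evenBasis_mulVec_one : evenBasis g *ᵥ 1 = 0 := by
  ext (k | k)
  · rw [mulVec, evenBasis_inl_dotProduct]
    rfl
  · simpa [mulVec, dotProduct, evenBasis_inr] using sum_ite_odd_interval (k : ℕ) k.2.le

lemma evenBasis_inl_dotProduct_inr (j k : Fin g) :
    evenBasis g (.inl j) ⬝ᵥ evenBasis g (.inr k) = if j = k then 1 else 0 := by
  rw [evenBasis_inl_dotProduct]
  simp only [evenBasis_inr, Fin.ext_iff]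
  rcases lt_trichotomy (j : ℕ) k with h | h | h
  · rw [if_neg (by omega), if_neg (by omega), if_neg (by omega), add_zero]
  · rw [if_neg (by omega), if_pos (by omega), if_pos h, zero_add]
  · rw [if_pos (by omega), if_pos (by omega), if_neg (by omega)]
    rfl

lemma evenBasis_mul_transpose : evenBasis g * (evenBasis g)ᵀ = J (Fin g) (ZMod 2) := by
  ext (j | j) (k | k)
  · change evenBasis g (.inl j) ⬝ᵥ evenBasis g (.inl k) = _
    rw [evenBasis_inl_dotProduct]
    have h : (2 * (j : ℕ) + 1) / 2 = j := by omega
    simp [evenBasis_inl, J, h, CharTwo.add_self_eq_zero]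
  · change evenBasis g (.inl j) ⬝ᵥ evenBasis g (.inr k) = _
    rw [evenBasis_inl_dotProduct_inr, J, neg_matrix_zmod_two]
    rfl
  · change evenBasis g (.inr j) ⬝ᵥ evenBasis g (.inl k) = _
    rw [dotProduct_comm, evenBasis_inl_dotProduct_inr]
    simp [J, Matrix.one_apply, eq_comm]
  · change evenBasis g (.inr j) ⬝ᵥ evenBasis g (.inr k) = _
    rw [evenBasis_inr_dotProduct_inr]
    simp [J]

lemma sum_evenBasis_inl_mul (i : Fin (2 * g + 2)) (f : ℕ → ZMod 2) :
    ∑ k : Fin g, evenBasis g (.inl k) i * f k = if (i : ℕ) < 2 * g then f (i / 2) else 0 := by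
  simp only [evenBasis_inl, ite_mul, one_mul, zero_mul]
  rw [Fin.sum_univ_eq_sum_range (fun k => if (i : ℕ) / 2 = k then f k else 0), Finset.sum_ite_eq]
  congr 1
  simp only [Finset.mem_range, eq_iff_iff]
  omega

lemma evenBasis_transpose_mul_J_mul :
    (evenBasis g)ᵀ * J (Fin g) (ZMod 2) * evenBasis g =
      1 + (vecMulVec 1 (fun j : Fin (2 * g + 2) => if (j : ℕ) ≤ 2 * g then 1 else 0) +
        vecMulVec (fun i : Fin (2 * g + 2) => if (i : ℕ) ≤ 2 * g then 0 else 1) 1) := by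
  ext i j
  have h : ((evenBasis g)ᵀ * J (Fin g) (ZMod 2) * evenBasis g) i j =
      (∑ k : Fin g, evenBasis g (.inl k) j * evenBasis g (.inr k) i) +
      ∑ k : Fin g, evenBasis g (.inl k) i * evenBasis g (.inr k) j := by
    simp [Matrix.mul_apply, J, neg_matrix_zmod_two, Matrix.one_apply, mul_comm]
  rw [h]
  have hi := sum_evenBasis_inl_mul i
    (fun k => if 2 * k + 1 ≤ (j : ℕ) ∧ (j : ℕ) ≤ 2 * g then 1 else 0)
  have hj := sum_evenBasis_inl_mul j
    (fun k => if 2 * k + 1 ≤ (i : ℕ) ∧ (i : ℕ) ≤ 2 * g then 1 else 0)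
  simp only [← evenBasis_inr] at hi hj
  rw [hi, hj]
  simp only [Matrix.add_apply, vecMulVec_apply, Pi.one_apply, one_mul, mul_one, Matrix.one_apply,
    Fin.ext_iff]
  have h₂ : (1 : ZMod 2) + 1 = 0 := rfl
  split_ifs <;> first | omega | grind

end Basis



/-- For `g ≥ 2` the symmetric group on `2g+2` letters embeds into the symplectic group
`Sp_g(𝔽₂)` (A'Campo: the image of the hyperelliptic mapping class group in `Sp_g(𝔽₂)` is
the symmetric group on the `2g+2` Weierstrass points). -/
theorem stmt2 (g : ℕ) (hg : 2 ≤ g) :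
    ∃ φ : Equiv.Perm (Fin (2 * g + 2)) →* Matrix.symplecticGroup (Fin g) (ZMod 2),
      Function.Injective φ := by
  exact exists_injective_hom_symplecticGroup (by rw [Fintype.card_fin]; omega)
    evenBasis_mul_transpose evenBasis_mulVec_one evenBasis_transpose_mul_J_mul
end

section
/- Let g ≥ 1 and let M be a 2g × 2g real matrix in the symplectic group Sp_g(ℝ), written in g × g blocks as M = [[A, B], [C, D]]. If Ω is a complex g × g matrix with Ωᵀ = Ω and Im Ω positive definite, then the matrix CΩ + D is invertible, and the matrix (AΩ + B)(CΩ + D)⁻¹ again satisfies ((AΩ + B)(CΩ + D)⁻¹)ᵀ = (AΩ + B)(CΩ + D)⁻¹ and has positive definite imaginary part. -/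
open Matrix

namespace Matrix

open scoped ComplexOrder

variable {n : Type*} [Fintype n]

/-- A real matrix is positive definite if and only if it is so as a complex matrix. -/
theorem posDef_map_ofReal_iff {H : Matrix n n ℝ} :
    (H.map Complex.ofReal).PosDef ↔ H.PosDef := by
  have hermitian_iff : (H.map Complex.ofReal).IsHermitian ↔ H.IsHermitian := by
    simp [← ext_iff, IsHermitian]
  rw [posDef_iff_dotProduct_mulVec, posDef_iff_dotProduct_mulVec, hermitian_iff]
  refine and_congr_right fun hH => ⟨fun h x hx => ?_, fun h x hx => ?_⟩
  · have hx' : (fun i => (x i : ℂ)) ≠ 0 := fun h0 =>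
      hx (funext fun i => Complex.ofReal_eq_zero.1 (congrFun h0 i))
    have := (Complex.pos_iff.1 (h hx')).1
    simpa [dotProduct, mulVec] using this
  · have re_eq : (star x ⬝ᵥ (H.map Complex.ofReal *ᵥ x)).re =
        star (fun i => (x i).re) ⬝ᵥ (H *ᵥ fun i => (x i).re) +
          star (fun i => (x i).im) ⬝ᵥ (H *ᵥ fun i => (x i).im) := by
      simp [dotProduct, mulVec, ← Finset.sum_add_distrib]
    have im_eq : (star x ⬝ᵥ (H.map Complex.ofReal *ᵥ x)).im = 0 :=
      (hermitian_iff.2 hH).im_star_dotProduct_mulVec_self x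
    have nonneg (y : n → ℝ) : 0 ≤ star y ⬝ᵥ (H *ᵥ y) :=
      (posDef_iff_dotProduct_mulVec.2 ⟨hH, h⟩).posSemidef.dotProduct_mulVec_nonneg y
    refine Complex.pos_iff.2 ⟨?_, im_eq.symm⟩
    rw [re_eq]
    by_cases hre : (fun i => (x i).re) = 0
    · have him : (fun i => (x i).im) ≠ 0 := fun him =>
        hx (funext fun i => Complex.ext (congrFun hre i) (congrFun him i))
      exact add_pos_of_nonneg_of_pos (nonneg _) (h him)
    · exact add_pos_of_pos_of_nonneg (h hre) (nonneg _)

/-- For a symmetric complex matrix, `Ω - Ωᴴ` is `2i` times the imaginary part of `Ω`. -/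
theorem IsSymm.sub_conjTranspose {m : Type*} {Ω : Matrix m m ℂ} (hΩ : Ω.IsSymm) :
    Ω - Ωᴴ = (2 * Complex.I) • (Ω.map Complex.im).map Complex.ofReal := by
  ext i j
  rw [sub_apply, conjTranspose_apply, hΩ.apply]
  simp [Complex.ext_iff, hΩ.apply i j, ← one_add_one_eq_two, add_mul]

/-- If `P` and `Q` satisfy the Hermitian and symmetric bilinear relations with respect to a point
`Ω` of the Siegel upper half space, then `P * Q⁻¹` is again such a point. -/
theorem isUnit_and_isSymm_and_posDef_im [DecidableEq n] {Ω P Q : Matrix n n ℂ}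
    (hsym : Ω.IsSymm) (hpos : (Ω.map Complex.im).PosDef)
    (hermitian_form : Qᴴ * P - Pᴴ * Q = Ω - Ωᴴ) (symmetric_form : Qᵀ * P = Pᵀ * Q) :
    IsUnit Q ∧ (P * Q⁻¹).IsSymm ∧ ((P * Q⁻¹).map Complex.im).PosDef := by
  rw [hsym.sub_conjTranspose] at hermitian_form
  have two_I_ne_zero : (2 * Complex.I) ≠ 0 := by simp
  have hY := posDef_map_ofReal_iff.2 hpos
  have hQ_unit : IsUnit Q := by
    rw [isUnit_iff_isUnit_det, isUnit_iff_ne_zero]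
    intro hdet
    obtain ⟨v, hv, hQv⟩ := exists_mulVec_eq_zero_iff.2 hdet
    have hvQ : star v ᵥ* Qᴴ = 0 := by rw [← star_mulVec, hQv, star_zero]
    have h : star v ⬝ᵥ ((Qᴴ * P - Pᴴ * Q) *ᵥ v) = 0 := by
      rw [sub_mulVec, ← mulVec_mulVec, ← mulVec_mulVec, hQv, mulVec_zero, sub_zero,
        dotProduct_mulVec, hvQ, zero_dotProduct]
    rw [hermitian_form, smul_mulVec, dotProduct_smul, smul_eq_mul] at h
    exact (hY.dotProduct_mulVec_pos hv).ne' ((mul_eq_zero.1 h).resolve_left two_I_ne_zero)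
  have hdet := (isUnit_iff_isUnit_det Q).1 hQ_unit
  have hWQ : P * Q⁻¹ * Q = P := nonsing_inv_mul_cancel_right Q P hdet
  have hW : (P * Q⁻¹).IsSymm := by
    rw [IsSymm]
    apply hQ_unit.mul_right_cancel
    apply ((isUnit_transpose Q).2 hQ_unit).mul_left_cancel
    rw [hWQ, symmetric_form, ← mul_assoc, ← transpose_mul, hWQ]
  refine ⟨hQ_unit, hW, ?_⟩
  rw [← posDef_map_ofReal_iff, ← hQ_unit.posDef_star_left_conjugate_iff]
  convert hY using 1
  apply smul_right_injective _ two_I_ne_zero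
  simp only
  rw [← hermitian_form, ← smul_mul_assoc, ← mul_smul_comm, ← hW.sub_conjTranspose,
    star_eq_conjTranspose, mul_sub, sub_mul, mul_assoc, hWQ, ← conjTranspose_mul, hWQ]

end Matrix

/-- The polarized symplectic identity for the numerator and denominator of the
fractional-linear action. -/
theorem SymplecticGroup.mul_sub_mul_eq_sub {n R : Type*} [Fintype n] [DecidableEq n] [CommRing R]
    {A B C D : Matrix n n R} (h : fromBlocks A B C D ∈ symplecticGroup n R) (S T : Matrix n n R) :
    (S * Cᵀ + Dᵀ) * (A * T + B) - (S * Aᵀ + Bᵀ) * (C * T + D) = T - S := by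
  obtain ⟨hAC, hBD, hAD⟩ := fromBlocks_mem_iff.1 h
  have hDA : Dᵀ * A - Bᵀ * C = 1 := by simpa using congrArg transpose hAD
  calc
    _ = S * (Cᵀ * A - Aᵀ * C) * T - S * (Aᵀ * D - Cᵀ * B) + (Dᵀ * A - Bᵀ * C) * T
        + (Dᵀ * B - Bᵀ * D) := by noncomm_ring
    _ = T - S := by rw [hAC, hBD, hAD, hDA]; noncomm_ring

/-- If `M = [[A, B], [C, D]] ∈ Sp_g(ℝ)` and `Ω` is in the Siegel upper half space
(`Ωᵀ = Ω`, `Im Ω` positive definite), then `CΩ + D` is invertible and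
`(AΩ + B)(CΩ + D)⁻¹` is again symmetric with positive definite imaginary part. -/
theorem stmt7 (g : ℕ) (hg : 1 ≤ g)
    (M : Matrix (Fin g ⊕ Fin g) (Fin g ⊕ Fin g) ℝ)
    (hM : M ∈ Matrix.symplecticGroup (Fin g) ℝ)
    (Ω : Matrix (Fin g) (Fin g) ℂ) (hsym : Ωᵀ = Ω) (hpos : (Ω.map Complex.im).PosDef) :
    let A : Matrix (Fin g) (Fin g) ℂ := M.toBlocks₁₁.map Complex.ofReal
    let B : Matrix (Fin g) (Fin g) ℂ := M.toBlocks₁₂.map Complex.ofReal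
    let C : Matrix (Fin g) (Fin g) ℂ := M.toBlocks₂₁.map Complex.ofReal
    let D : Matrix (Fin g) (Fin g) ℂ := M.toBlocks₂₂.map Complex.ofReal
    IsUnit (C * Ω + D) ∧
      ((A * Ω + B) * (C * Ω + D)⁻¹)ᵀ = (A * Ω + B) * (C * Ω + D)⁻¹ ∧
      (((A * Ω + B) * (C * Ω + D)⁻¹).map Complex.im).PosDef := by
  intro A B C D
  have hmem : fromBlocks A B C D ∈ symplecticGroup (Fin g) ℂ := by
    have h := SymplecticGroup.map_mem hM Complex.ofRealHom
    rwa [← fromBlocks_toBlocks M, fromBlocks_map] at h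
  have conjTranspose_ofReal (N : Matrix (Fin g) (Fin g) ℝ) :
      (N.map Complex.ofReal)ᴴ = (N.map Complex.ofReal)ᵀ := by
    ext; simp
  set P := A * Ω + B with hP
  set Q := C * Ω + D with hQ
  have hermitian_form : Qᴴ * P - Pᴴ * Q = Ω - Ωᴴ := by
    rw [← SymplecticGroup.mul_sub_mul_eq_sub hmem Ωᴴ Ω]
    simp only [hP, hQ, conjTranspose_add, conjTranspose_mul, A, B, C, D, conjTranspose_ofReal]
  have symmetric_form : Qᵀ * P = Pᵀ * Q := by
    have h := SymplecticGroup.mul_sub_mul_eq_sub hmem Ω Ω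
    rw [sub_self, sub_eq_zero] at h
    simpa only [hP, hQ, transpose_add, transpose_mul, hsym] using h
  exact isUnit_and_isSymm_and_posDef_im hsym hpos hermitian_form symmetric_form
end

section
/- Let g ≥ 1. For every complex g × g matrix Ω with Ωᵀ = Ω and Im Ω positive definite, there exists a matrix M = [[A, B], [C, D]] in the symplectic group Sp_g(ℝ) such that CΩ' + D is invertible and (AΩ' + B)(CΩ' + D)⁻¹ = Ω, where Ω' = i·I_g is i times the g × g identity matrix. In other words, the fractional-linear action of Sp_g(ℝ) on the Siegel upper half space 𝔥_g is transitive. -/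
open Matrix

/-- For `B` invertible and `X` symmetric, `[[Bᵀ, X B⁻¹], [0, B⁻¹]]` is symplectic; its
fractional-linear action is `Ω ↦ Bᵀ Ω B + X`. -/
theorem Matrix.fromBlocks_transpose_mul_inv_mem_symplecticGroup {l R : Type*} [DecidableEq l]
    [Fintype l] [CommRing R] {B X : Matrix l l R} (hB : IsUnit B.det) (hX : Xᵀ = X) :
    fromBlocks Bᵀ (X * B⁻¹) 0 B⁻¹ ∈ symplecticGroup l R := by
  have hBt : Bᵀ * B⁻¹ᵀ = 1 := by
    rw [← transpose_mul, nonsing_inv_mul _ hB, transpose_one]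
  have hcomm : X * B⁻¹ * B = X := by rw [Matrix.mul_assoc, nonsing_inv_mul _ hB, Matrix.mul_one]
  rw [SymplecticGroup.mem_iff, J, fromBlocks_transpose, fromBlocks_multiply, fromBlocks_multiply]
  simp [hX, hBt, hcomm, nonsing_inv_mul _ hB, ← Matrix.mul_assoc]

open scoped MatrixOrder in
/-- A positive definite real matrix factors as `Bᵀ * B` with `B` invertible. -/
theorem Matrix.PosDef.exists_isUnit_det_eq_transpose_mul {n : Type*} [Fintype n] [DecidableEq n]
    {Y : Matrix n n ℝ} (hY : Y.PosDef) : ∃ B : Matrix n n ℝ, IsUnit B.det ∧ Y = Bᵀ * B := by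
  obtain ⟨B, hB⟩ := CStarAlgebra.nonneg_iff_eq_star_mul_self.mp hY.posSemidef.nonneg
  rw [star_eq_conjTranspose, conjTranspose_eq_transpose_of_trivial] at hB
  have hdet : IsUnit (Bᵀ.det * B.det) := by
    rw [← det_mul, ← hB]
    exact (isUnit_iff_isUnit_det Y).mp hY.isUnit
  exact ⟨B, isUnit_of_mul_isUnit_right hdet, hB⟩

/-- The fractional-linear action of `Sp_g(ℝ)` on the Siegel upper half space `𝔥_g` is
transitive: every `Ω ∈ 𝔥_g` is of the form `M · (i·I_g) = (A(iI) + B)(C(iI) + D)⁻¹` for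
some `M = [[A, B], [C, D]] ∈ Sp_g(ℝ)`. -/
theorem stmt8 (g : ℕ) (hg : 1 ≤ g)
    (Ω : Matrix (Fin g) (Fin g) ℂ) (hsym : Ωᵀ = Ω) (hpos : (Ω.map Complex.im).PosDef) :
    ∃ M ∈ Matrix.symplecticGroup (Fin g) ℝ,
      IsUnit (M.toBlocks₂₁.map Complex.ofReal * (Complex.I • (1 : Matrix (Fin g) (Fin g) ℂ))
          + M.toBlocks₂₂.map Complex.ofReal) ∧
      (M.toBlocks₁₁.map Complex.ofReal * (Complex.I • (1 : Matrix (Fin g) (Fin g) ℂ))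
          + M.toBlocks₁₂.map Complex.ofReal) *
        (M.toBlocks₂₁.map Complex.ofReal * (Complex.I • (1 : Matrix (Fin g) (Fin g) ℂ))
          + M.toBlocks₂₂.map Complex.ofReal)⁻¹ = Ω := by
  obtain ⟨B, hB, hY⟩ := hpos.exists_isUnit_det_eq_transpose_mul
  have hX : (Ω.map Complex.re)ᵀ = Ω.map Complex.re := by rw [← transpose_map, hsym]
  have hinv : B⁻¹.map Complex.ofReal * B.map Complex.ofReal = 1 := by
    have h := congrArg Complex.ofRealHom.mapMatrix (nonsing_inv_mul B hB)
    rwa [map_mul, map_one] at h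
  have hBinv : (B⁻¹.map Complex.ofReal)⁻¹ = B.map Complex.ofReal := inv_eq_right_inv hinv
  have hmul : ∀ P Q : Matrix (Fin g) (Fin g) ℝ,
      (P * Q).map Complex.ofReal = P.map Complex.ofReal * Q.map Complex.ofReal :=
    fun P Q => map_mul Complex.ofRealHom.mapMatrix P Q
  have hzero : (0 : Matrix (Fin g) (Fin g) ℝ).map Complex.ofReal = 0 :=
    map_zero Complex.ofRealHom.mapMatrix
  refine ⟨_, fromBlocks_transpose_mul_inv_mem_symplecticGroup hB hX, ?_, ?_⟩
  · rw [toBlocks_fromBlocks₂₁, toBlocks_fromBlocks₂₂, hzero, Matrix.zero_mul, zero_add]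
    exact IsUnit.of_mul_eq_one _ hinv
  · rw [toBlocks_fromBlocks₁₁, toBlocks_fromBlocks₁₂, toBlocks_fromBlocks₂₁,
      toBlocks_fromBlocks₂₂, hzero, Matrix.zero_mul, zero_add, hBinv, Matrix.add_mul, hmul,
      Matrix.mul_assoc _ (B⁻¹.map _), hinv, Matrix.mul_one, Matrix.mul_smul, Matrix.mul_one,
      Matrix.smul_mul, ← hmul, ← hY]
    ext i j
    simp [mul_comm Complex.I, add_comm, Complex.re_add_im]
end
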